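/- arXiv:2409.02896 — 5 statements merged into one kernel-verified Lean document; each statement's English description precedes it below -/
import Mathlib

section
/- Let X be a standard Borel space and E a countable Borel equivalence relation on X all of whose classes are infinite (E is aperiodic). Then there exists a sequence of Borel sets X ⊇ A_0 ⊇ A_1 ⊇ A_2 ⊇ ⋯ such that every A_n meets every E-class and ⋂_{n ∈ ℕ} A_n = ∅. (Slaman–Steel marker lemma: every aperiodic CBER admits a vanishing sequence of Borel markers.) -/
open Set Filter Topology MeasureTheory TopologicalSpace Metric Bornology PiNat

namespace MarkerLemma

section Strategies

/-- The position reached when the strategy `φ` answers the moves listed, latest first, in the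
argument. -/
def respond (φ : List ℕ → ℕ) : List ℕ → List ℕ
  | [] => []
  | i :: s => φ (i :: s) :: respond φ s

theorem respond_res (φ : List ℕ → ℕ) (y : ℕ → ℕ) (n : ℕ) :
    respond φ (res y n) = res (fun k => φ (res y (k + 1))) n := by
  induction n with
  | zero => rfl
  | succ n ih => simp [res_succ, respond, ih]

theorem measurableSet_respond_eq (s t : List ℕ) :
    MeasurableSet {φ : List ℕ → ℕ | respond φ s = t} := by
  induction s generalizing t with
  | nil => simp [respond]
  | cons i s ih =>
    cases t with
    | nil => simp [respond]
    | cons j t =>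
      simp only [respond, List.cons.injEq]
      exact ((measurable_pi_apply (i :: s)) (measurableSet_singleton j)).inter (ih t)

theorem exists_respond {a : List ℕ → Prop} (ha : ∀ i s, a (i :: s) → a s)
    {Q : List ℕ → List ℕ → Prop} (h0 : a [] → Q [] [])
    (hs : ∀ i s t, a (i :: s) → Q s t → ∃ j, Q (i :: s) (j :: t)) :
    ∃ φ, ∀ s, a s → Q s (respond φ s) := by
  have : ∀ i s t, ∃ j, a (i :: s) → Q s t → Q (i :: s) (j :: t) := by
    intro i s t
    by_cases h : a (i :: s) ∧ Q s t
    · obtain ⟨j, hj⟩ := hs i s t h.1 h.2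
      exact ⟨j, fun _ _ => hj⟩
    · exact ⟨0, fun h1 h2 => absurd ⟨h1, h2⟩ h⟩
  choose J hJ using this
  let h : List ℕ → List ℕ := fun s => List.rec [] (fun i s t => J i s t :: t) s
  let φ : List ℕ → ℕ := fun s => (h s).headI
  have hφ : ∀ s, respond φ s = h s := by
    intro s
    induction s with
    | nil => rfl
    | cons i s ih => simp only [respond, ih]; rfl
  refine ⟨φ, fun s => ?_⟩
  rw [hφ]
  induction s with
  | nil => exact h0
  | cons i s ih => exact fun hi => hJ i s (h s) hi (ih (ha _ _ hi))

/-- Any two trees on `ℕ` are comparable: one of them admits a length-preserving monotone map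
to the other. -/
theorem exists_respond_or {a b : List ℕ → Prop} (ha : ∀ i s, a (i :: s) → a s)
    (hb : ∀ i s, b (i :: s) → b s) :
    (∃ φ, ∀ s, a s → b (respond φ s)) ∨ ∃ ψ, ∀ t, b t → a (respond ψ t) := by
  let G : List ℕ → List ℕ → Prop := fun s t => ∃ R : List ℕ → List ℕ → Prop, R s t ∧
    ∀ s t, R s t → b t ∧ ∀ i, a (i :: s) → ∃ j, R (i :: s) (j :: t)
  have G_unfold : ∀ s t, G s t → b t ∧ ∀ i, a (i :: s) → ∃ j, G (i :: s) (j :: t) := by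
    rintro s t ⟨R, hR, h⟩
    refine ⟨(h s t hR).1, fun i hi => ?_⟩
    obtain ⟨j, hj⟩ := (h s t hR).2 i hi
    exact ⟨j, R, hj, h⟩
  have G_fold : ∀ s t, b t → (∀ i, a (i :: s) → ∃ j, G (i :: s) (j :: t)) → G s t := by
    intro s t hbt h
    refine ⟨fun s' t' => G s' t' ∨ (s' = s ∧ t' = t), Or.inr ⟨rfl, rfl⟩, ?_⟩
    rintro s' t' (h' | ⟨rfl, rfl⟩)
    · refine ⟨(G_unfold _ _ h').1, fun i hi => ?_⟩
      obtain ⟨j, hj⟩ := (G_unfold _ _ h').2 i hi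
      exact ⟨j, Or.inl hj⟩
    · refine ⟨hbt, fun i hi => ?_⟩
      obtain ⟨j, hj⟩ := h i hi
      exact ⟨j, Or.inl hj⟩
  by_cases hG : a [] → G [] []
  · left
    obtain ⟨φ, hφ⟩ := exists_respond ha (Q := G) hG
      (fun i s t hi h => (G_unfold s t h).2 i hi)
    exact ⟨φ, fun s hs => (G_unfold _ _ (hφ s hs)).1⟩
  · right
    rw [Classical.not_imp] at hG
    obtain ⟨φ, hφ⟩ := exists_respond hb (Q := fun t s => a s ∧ ¬ G s t) (fun _ => hG) (by
      rintro j t s hj ⟨has, hn⟩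
      by_contra! hc
      refine hn (G_fold s t (hb _ _ hj) fun i hi => ?_)
      by_contra! hc'
      exact hc' j (hc i hi))
    exact ⟨φ, fun t ht => (hφ t ht).1⟩

end Strategies

section Analytic

variable {X : Type*} [TopologicalSpace X]

/-- Every analytic set is the result of the Suslin operation on a decreasing scheme of closed
sets. -/
theorem exists_suslin_scheme [T3Space X] {A : Set X} (hA : AnalyticSet A) :
    ∃ F : List ℕ → Set X, (∀ s, IsClosed (F s)) ∧ (∀ i s, F (i :: s) ⊆ F s) ∧
      ∀ x, x ∈ A ↔ ∃ y : ℕ → ℕ, ∀ n, x ∈ F (res y n) := by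
  rw [AnalyticSet] at hA
  rcases hA with rfl | ⟨f, hf, rfl⟩
  · exact ⟨fun _ => ∅, by simp, by simp, by simp⟩
  refine ⟨fun s => closure (f '' {y | res y s.length = s}), fun _ => isClosed_closure, ?_, ?_⟩
  · intro i s
    refine closure_mono (image_mono fun y hy => ?_)
    simp only [List.length_cons, res_succ, mem_ofPred_eq, List.cons.injEq] at hy
    exact hy.2
  · intro x
    constructor
    · rintro ⟨y, rfl⟩
      exact ⟨y, fun n => subset_closure ⟨y, by simp, rfl⟩⟩
    · rintro ⟨y, hy⟩
      refine ⟨y, ?_⟩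
      by_contra hne
      obtain ⟨v, hv, w, hw, hvw⟩ := Filter.disjoint_iff.1 (disjoint_nhds_nhds.2 hne)
      obtain ⟨v', hv', hv'c, hv'v⟩ := exists_mem_nhds_isClosed_subset hv
      obtain ⟨n, hn⟩ : ∃ n, cylinder y n ⊆ f ⁻¹' v' := by
        have : f ⁻¹' v' ∈ 𝓝 y := hf.continuousAt hv'
        obtain ⟨u, ⟨z, n, rfl⟩, hyu, hu⟩ :=
          (isTopologicalBasis_cylinders (fun _ : ℕ => ℕ)).mem_nhds_iff.1 this
        exact ⟨n, by rwa [mem_cylinder_iff_eq.1 hyu]⟩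
      have h1 : x ∈ v' := by
        refine closure_minimal ?_ hv'c (hy n)
        rintro _ ⟨z, hz, rfl⟩
        refine hn ?_
        rw [cylinder_eq_res]
        simpa using hz
      exact disjoint_left.1 hvw (hv'v h1) (mem_of_mem_nhds hw)

/-- **Lusin's second separation theorem**. -/
theorem exists_coanalytic_separation [PolishSpace X] {A B : Set X}
    (hA : AnalyticSet A) (hB : AnalyticSet B) :
    ∃ C D : Set X, AnalyticSet Cᶜ ∧ AnalyticSet Dᶜ ∧ A \ B ⊆ C ∧ B \ A ⊆ D ∧ Disjoint C D := by
  borelize X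
  have key : ∀ F G : List ℕ → Set X, (∀ s, IsClosed (F s)) → (∀ s, IsClosed (G s)) →
      AnalyticSet {x | ∃ φ, ∀ s, x ∈ F s → x ∈ G (respond φ s)} := by
    intro F G hF hG
    have hm : MeasurableSet
        {p : X × (List ℕ → ℕ) | ∀ s, p.1 ∈ F s → p.1 ∈ G (respond p.2 s)} := by
      simp only [ofPred_forall]
      refine MeasurableSet.iInter fun s => ?_
      have : {p : X × (List ℕ → ℕ) | p.1 ∈ F s → p.1 ∈ G (respond p.2 s)} =
          (Prod.fst ⁻¹' (F s)ᶜ) ∪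
            ⋃ t, (Prod.snd ⁻¹' {φ | respond φ s = t}) ∩ (Prod.fst ⁻¹' (G t)) := by
        ext p
        simp [imp_iff_not_or]
      rw [this]
      exact (measurable_fst (hF s).measurableSet.compl).union (MeasurableSet.iUnion fun t =>
        (measurable_snd (measurableSet_respond_eq s t)).inter
          (measurable_fst (hG t).measurableSet))
    convert! hm.analyticSet.image_of_continuous continuous_fst using 1
    ext x
    simp
  obtain ⟨F, hFc, hFm, hF⟩ := exists_suslin_scheme hA
  obtain ⟨G, hGc, hGm, hG⟩ := exists_suslin_scheme hB
  refine ⟨{x | ∃ φ, ∀ s, x ∈ F s → x ∈ G (respond φ s)}ᶜ,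
    {x | ∃ φ, ∀ s, x ∈ G s → x ∈ F (respond φ s)}ᶜ, ?_, ?_, ?_, ?_, ?_⟩
  · simpa using key F G hFc hGc
  · simpa using key G F hGc hFc
  · rintro x ⟨hxA, hxB⟩ ⟨φ, hφ⟩
    obtain ⟨y, hy⟩ := (hF x).1 hxA
    exact hxB ((hG x).2 ⟨_, fun n => respond_res φ y n ▸ hφ _ (hy n)⟩)
  · rintro x ⟨hxB, hxA⟩ ⟨φ, hφ⟩
    obtain ⟨y, hy⟩ := (hG x).1 hxB
    exact hxA ((hF x).2 ⟨_, fun n => respond_res φ y n ▸ hφ _ (hy n)⟩)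
  · rw [disjoint_left]
    intro x h1 h2
    rcases exists_respond_or (a := fun s => x ∈ F s) (b := fun s => x ∈ G s)
      (fun i s h => hFm i s h) (fun i s h => hGm i s h) with h | h
    · exact h1 h
    · exact h2 h

theorem analyticSet_biInter [PolishSpace X] {ι : Type*} [Countable ι] {p : ι → Prop}
    {s : ι → Set X} (hs : ∀ i, p i → AnalyticSet (s i)) :
    AnalyticSet (⋂ (i) (_ : p i), s i) := by
  have huniv : AnalyticSet (univ : Set X) := isClosed_univ.analyticSet
  cases isEmpty_or_nonempty ι with
  | inl h => simpa using huniv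
  | inr h =>
    refine AnalyticSet.iInter fun i => ?_
    by_cases hi : p i
    · simpa [hi] using hs i hi
    · simpa [hi] using huniv

theorem analyticSet_union {A B : Set X} (hA : AnalyticSet A) (hB : AnalyticSet B) :
    AnalyticSet (A ∪ B) := by
  rw [union_eq_iUnion]
  exact AnalyticSet.iUnion fun b => by cases b <;> assumption

/-- The points with exactly one preimage under a continuous map on a Polish space lie in a
coanalytic subset of the range. -/
theorem exists_coanalytic_subset_range [PolishSpace X] {P : Type*} [TopologicalSpace P]
    [PolishSpace P] {f : P → X} (f_cont : Continuous f) :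
    ∃ H : Set X, AnalyticSet Hᶜ ∧ H ⊆ range f ∧ ∀ x, (∃! y, f y = x) → x ∈ H := by
  borelize X
  let := upgradeIsCompletelyMetrizable P
  obtain ⟨b, b_count, b_nonempty, hb⟩ :
    ∃ b : Set (Set P), b.Countable ∧ ∅ ∉ b ∧ IsTopologicalBasis b := exists_countable_basis P
  have : Countable b := b_count.to_subtype
  have hsep : ∀ p : b × b, ∃ C D : Set X, AnalyticSet Cᶜ ∧ AnalyticSet Dᶜ ∧
      f '' p.1.1 \ f '' p.2.1 ⊆ C ∧ f '' p.2.1 \ f '' p.1.1 ⊆ D ∧ Disjoint C D := fun p =>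
    exists_coanalytic_separation ((hb.isOpen p.1.2).analyticSet_image f_cont)
      ((hb.isOpen p.2.2).analyticSet_image f_cont)
  choose C D hC hD hCs hDs hCD using hsep
  let E : b → Set X := fun s =>
    closure (f '' s) ∩ ⋂ (t : b) (_ : Disjoint s.1 t.1), C (s, t) ∩ D (t, s)
  obtain ⟨u, u_anti, u_pos, u_lim⟩ :
      ∃ u : ℕ → ℝ, StrictAnti u ∧ (∀ n : ℕ, 0 < u n) ∧ Tendsto u atTop (𝓝 0) :=
    exists_seq_strictAnti_tendsto (0 : ℝ)
  let F : ℕ → Set X := fun n => ⋃ (s : b) (_ : IsBounded s.1 ∧ diam s.1 ≤ u n), E s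
  refine ⟨⋂ n, F n, ?_, ?_, ?_⟩
  · have hE : ∀ s, AnalyticSet (E s)ᶜ := by
      intro s
      simp only [E, compl_inter, compl_iInter]
      refine analyticSet_union isClosed_closure.measurableSet.compl.analyticSet ?_
      refine AnalyticSet.iUnion fun t => ?_
      by_cases ht : Disjoint s.1 t.1
      · simpa [ht] using analyticSet_union (hC (s, t)) (hD (t, s))
      · simpa [ht] using analyticSet_empty
    simp only [F, compl_iInter, compl_iUnion]
    exact AnalyticSet.iUnion fun n => analyticSet_biInter fun s _ => hE s
  · intro x hx
    have C1 : ∀ n, ∃ (s : b) (_ : IsBounded s.1 ∧ diam s.1 ≤ u n), x ∈ E s := fun n => by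
      simpa only [F, mem_iUnion] using mem_iInter.1 hx n
    choose s hs hxs using C1
    have C2 : ∀ n, (s n).1.Nonempty := by
      intro n
      rw [nonempty_iff_ne_empty]
      exact fun h => b_nonempty (h ▸ (s n).2)
    choose y hy using C2
    have I : ∀ m n, ((s m).1 ∩ (s n).1).Nonempty := by
      intro m n
      rw [← not_disjoint_iff_nonempty_inter]
      intro h
      have h1 : x ∈ C (s m, s n) ∩ D (s n, s m) := mem_iInter₂.1 (hxs m).2 (s n) h
      have h2 : x ∈ C (s n, s m) ∩ D (s m, s n) := mem_iInter₂.1 (hxs n).2 (s m) h.symm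
      exact disjoint_left.1 (hCD _) h1.1 h2.2
    have cauchy_y : CauchySeq y := by
      have : Tendsto (fun n => 2 * u n) atTop (𝓝 0) := by
        simpa only [mul_zero] using u_lim.const_mul 2
      refine cauchySeq_of_le_tendsto_0' (fun n => 2 * u n) (fun m n hmn => ?_) this
      rcases I m n with ⟨z, zsm, zsn⟩
      calc
        dist (y m) (y n) ≤ dist (y m) z + dist z (y n) := dist_triangle _ _ _
        _ ≤ u m + u n :=
          (add_le_add ((dist_le_diam_of_mem (hs m).1 (hy m) zsm).trans (hs m).2)
            ((dist_le_diam_of_mem (hs n).1 zsn (hy n)).trans (hs n).2))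
        _ ≤ 2 * u m := by linarith [u_anti.antitone hmn]
    obtain ⟨z, hz⟩ := cauchySeq_tendsto_of_complete cauchy_y
    refine ⟨z, ?_⟩
    by_contra hne
    obtain ⟨v, hv, w, hw, hvw⟩ := Filter.disjoint_iff.1 (disjoint_nhds_nhds.2 hne)
    obtain ⟨v', hv', hv'c, hv'v⟩ := exists_mem_nhds_isClosed_subset hv
    obtain ⟨δ, δpos, hδ⟩ := Metric.mem_nhds_iff.1 (f_cont.continuousAt hv' : f ⁻¹' v' ∈ 𝓝 z)
    obtain ⟨n, hn⟩ : ∃ n, u n + dist (y n) z < δ := by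
      have : Tendsto (fun n => u n + dist (y n) z) atTop (𝓝 0) := by
        simpa only [add_zero] using u_lim.add (tendsto_iff_dist_tendsto_zero.1 hz)
      exact ((tendsto_order.1 this).2 _ δpos).exists
    have h1 : x ∈ v' := by
      refine closure_minimal ?_ hv'c (hxs n).1
      rintro _ ⟨a, ha, rfl⟩
      refine hδ ?_
      calc
        dist a z ≤ dist a (y n) + dist (y n) z := dist_triangle _ _ _
        _ ≤ u n + dist (y n) z := by
          gcongr
          exact (dist_le_diam_of_mem (hs n).1 ha (hy n)).trans (hs n).2
        _ < δ := hn
    exact disjoint_left.1 hvw (hv'v h1) (mem_of_mem_nhds hw)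
  · rintro x ⟨y, rfl, hy⟩
    refine mem_iInter.2 fun n => ?_
    obtain ⟨s, sb, ys, hs⟩ : ∃ s ∈ b, y ∈ s ∧ s ⊆ ball y (u n / 2) :=
      hb.mem_nhds_iff.1 (ball_mem_nhds _ (half_pos (u_pos n)))
    have diam_s : diam s ≤ u n := by
      refine (diam_mono hs isBounded_ball).trans ((diam_ball (half_pos (u_pos n)).le).trans ?_)
      linarith
    refine mem_iUnion₂.2 ⟨⟨s, sb⟩, ⟨isBounded_ball.subset hs, diam_s⟩, ?_⟩
    refine ⟨subset_closure (mem_image_of_mem _ ys), mem_iInter₂.2 fun t ht => ?_⟩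
    have hyt : f y ∉ f '' t.1 := by
      rintro ⟨z, hz, hzy⟩
      exact disjoint_left.1 ht ys (hy z hzy ▸ hz)
    exact ⟨hCs _ ⟨mem_image_of_mem _ ys, hyt⟩, hDs _ ⟨mem_image_of_mem _ ys, hyt⟩⟩

theorem exists_isolated_of_countable {P : Type*} [TopologicalSpace P] [PolishSpace P] {S : Set P}
    (hS : IsClosed S) (hc : S.Countable) (hne : S.Nonempty) :
    ∃ y ∈ S, ∃ U : Set P, IsOpen U ∧ y ∈ U ∧ ∀ z ∈ U ∩ S, z = y := by
  let := upgradeIsCompletelyMetrizable P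
  by_contra! h
  have hp : Perfect S := by
    refine ⟨hS, preperfect_iff_nhds.2 fun y hy U hU => ?_⟩
    obtain ⟨V, hVU, hV, hyV⟩ := _root_.mem_nhds_iff.1 hU
    obtain ⟨z, hz, hzy⟩ := h y hy V hV hyV
    exact ⟨z, ⟨hVU hz.1, hz.2⟩, hzy⟩
  obtain ⟨f, hf, -, hinj⟩ := hp.exists_nat_bool_injection hne
  have : Countable (ℕ → Bool) := by
    have := (hc.mono hf).to_subtype
    exact (rangeFactorization_injective.2 hinj).countable
  rw [← Cardinal.mk_le_aleph0_iff] at this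
  refine absurd this (not_le.2 ?_)
  simpa using Cardinal.cantor Cardinal.aleph0

/-- A continuous countable-to-one image of a Polish space is Borel. -/
theorem measurableSet_range_of_continuous [PolishSpace X] [MeasurableSpace X] [BorelSpace X]
    {P : Type*} [TopologicalSpace P] [PolishSpace P] {f : P → X} (hf : Continuous f)
    (hc : ∀ x, (f ⁻¹' {x}).Countable) : MeasurableSet (range f) := by
  obtain ⟨b, b_count, -, hb⟩ := exists_countable_basis P
  have : Countable b := b_count.to_subtype
  have hH : ∀ s : b, ∃ H : Set X, AnalyticSet Hᶜ ∧ H ⊆ range f ∧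
      ∀ x, (∃! y : s.1, f y = x) → x ∈ H := by
    intro s
    have := (hb.isOpen s.2).polishSpace
    obtain ⟨H, h1, h2, h3⟩ := exists_coanalytic_subset_range
      (hf.comp (continuous_subtype_val (p := fun y => y ∈ s.1)))
    exact ⟨H, h1, h2.trans (range_comp_subset_range _ _), h3⟩
  choose H h1 h2 h3 using hH
  have heq : range f = ⋃ s, H s := by
    refine Subset.antisymm ?_ (iUnion_subset h2)
    rintro x hx
    obtain ⟨y, hy, U, hU, hyU, huniq⟩ := exists_isolated_of_countable
      (isClosed_singleton.preimage hf) (hc x) (by obtain ⟨y, hy⟩ := hx; exact ⟨y, hy⟩)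
    obtain ⟨s, sb, ys, hs⟩ := hb.mem_nhds_iff.1 (hU.mem_nhds hyU)
    refine mem_iUnion.2 ⟨⟨s, sb⟩, h3 _ _ ⟨⟨y, ys⟩, hy, fun z hz => ?_⟩⟩
    exact Subtype.ext (huniq z ⟨hs z.2, hz⟩)
  refine AnalyticSet.measurableSet_of_compl (analyticSet_range_of_polishSpace hf) ?_
  rw [heq, compl_iUnion]
  simpa using analyticSet_biInter (p := fun _ => True) fun s _ => h1 s

end Analytic

/-- A Borel countable-to-one image of a standard Borel space is Borel. -/
theorem measurableSet_range_of_countable_fibers {X P : Type*} [MeasurableSpace X]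
    [StandardBorelSpace X] [MeasurableSpace P] [StandardBorelSpace P] {f : P → X}
    (hf : Measurable f) (hc : ∀ x, (f ⁻¹' {x}).Countable) : MeasurableSet (range f) := by
  let := upgradeStandardBorel X
  let := upgradeStandardBorel P
  obtain ⟨τ, -, hcont, hpol⟩ := hf.exists_continuous
  exact @measurableSet_range_of_continuous X _ _ _ _ P τ hpol f hcont hc

/-- **Lusin–Novikov**: the projection of a Borel set with countable sections is Borel. -/
theorem measurableSet_projection {X Y : Type*} [MeasurableSpace X]
    [StandardBorelSpace X] [MeasurableSpace Y] [StandardBorelSpace Y] {B : Set (X × Y)}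
    (hB : MeasurableSet B) (hc : ∀ x, {y | (x, y) ∈ B}.Countable) :
    MeasurableSet {x | ∃ y, (x, y) ∈ B} := by
  have := hB.standardBorel
  convert! measurableSet_range_of_countable_fibers (f := fun p : B => p.1.1)
    (measurable_fst.comp measurable_subtype_coe) (fun x => ?_) using 1
  · ext x
    simp
  · refine MapsTo.countable_of_injOn (f := fun p : B => p.1.2) (t := {y | (x, y) ∈ B}) ?_ ?_ (hc x)
    · rintro ⟨⟨a, y⟩, h⟩ (rfl : a = x)
      exact h
    · rintro ⟨⟨a, y⟩, h⟩ (rfl : a = x) ⟨⟨a', y'⟩, h'⟩ (rfl : a' = a) (rfl : y = y')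
      rfl

theorem infinite_iff_forall_exists_injective {α : Type*} {S : Set α} :
    S.Infinite ↔ ∀ k : ℕ, ∃ y : Fin k → α, Function.Injective y ∧ ∀ i, y i ∈ S := by
  constructor
  · intro h k
    have := h.to_subtype
    let e := Infinite.natEmbedding S
    exact ⟨fun i => e i, fun i j hij => Fin.ext (e.injective (Subtype.ext hij)),
      fun i => (e i).2⟩
  · intro h hfin
    obtain ⟨y, hy, hyS⟩ := h (S.ncard + 1)
    have h1 : (range y).ncard ≤ S.ncard := ncard_le_ncard (range_subset_iff.2 hyS) hfin
    rw [← image_univ, ncard_image_of_injective _ hy, ncard_univ, Nat.card_fin] at h1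
    omega

/-- The points at which a Borel set with countable sections has infinite section form a Borel
set. -/
theorem measurableSet_infinite_section {X Y : Type*} [MeasurableSpace X]
    [StandardBorelSpace X] [MeasurableSpace Y] [StandardBorelSpace Y] {B : Set (X × Y)}
    (hB : MeasurableSet B) (hc : ∀ x, {y | (x, y) ∈ B}.Countable) :
    MeasurableSet {x | {y | (x, y) ∈ B}.Infinite} := by
  simp only [infinite_iff_forall_exists_injective, ofPred_forall]
  refine MeasurableSet.iInter fun k => ?_
  refine measurableSet_projection
    (B := {p : X × (Fin k → Y) | Function.Injective p.2 ∧ ∀ i, (p.1, p.2 i) ∈ B}) ?_ ?_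
  · have hinj : MeasurableSet {p : X × (Fin k → Y) | Function.Injective p.2} := by
      simp only [Function.Injective, ofPred_forall]
      refine MeasurableSet.iInter fun i => MeasurableSet.iInter fun j => ?_
      by_cases hij : i = j
      · simp [hij]
      · simp only [hij, imp_false]
        exact (measurableSet_eq_fun ((measurable_pi_apply i).comp measurable_snd)
          ((measurable_pi_apply j).comp measurable_snd)).compl
    have hmem : MeasurableSet {p : X × (Fin k → Y) | ∀ i, (p.1, p.2 i) ∈ B} := by
      simp only [ofPred_forall]
      exact MeasurableSet.iInter fun i =>
        (measurable_fst.prodMk ((measurable_pi_apply i).comp measurable_snd)) hB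
    exact hinj.inter hmem
  · intro x
    refine (countable_univ_pi fun _ : Fin k => hc x).mono ?_
    rintro y ⟨-, hy⟩ i -
    exact hy i

end MarkerLemma

/-- **Slaman–Steel marker lemma**: every aperiodic countable Borel equivalence relation
admits a vanishing sequence of Borel markers. -/
theorem stmt_14 {X : Type*} [MeasurableSpace X] [StandardBorelSpace X]
    (E : X → X → Prop) (hE : Equivalence E)
    (hBorel : MeasurableSet {p : X × X | E p.1 p.2})
    (hcount : ∀ x : X, {y : X | E x y}.Countable)
    (haper : ∀ x : X, {y : X | E x y}.Infinite) :
    ∃ A : ℕ → Set X, (∀ n, MeasurableSet (A n)) ∧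
      (∀ n, A (n + 1) ⊆ A n) ∧
      (∀ n, ∀ x : X, (A n ∩ {y : X | E x y}).Nonempty) ∧
      (⋂ n, A n) = ∅ := by
  let g := MeasurableSpace.mapNatBool X
  have hg : Measurable g := MeasurableSpace.measurable_mapNatBool X
  have hg_inj : Function.Injective g := MeasurableSpace.injective_mapNatBool X
  have class_eq : ∀ {x y}, E x y → {z | E x z} = {z | E y z} := fun h =>
    Set.ext fun z => ⟨hE.trans (hE.symm h), hE.trans h⟩
  let L : ℕ → Set X → Set X := fun n S => S ∩ {x | g x n = false}
  let I : ℕ → Set X → Set X := fun n S => {x | (L n S ∩ {y | E x y}).Infinite}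
  let next : ℕ → Set X → Set X := fun n S =>
    S ∩ (({x | g x n = false} ∩ I n S) ∪ ({x | g x n = false}ᶜ ∩ (I n S)ᶜ))
  have hbit : ∀ n, MeasurableSet {x | g x n = false} := fun n =>
    ((measurable_pi_apply n).comp hg) (measurableSet_singleton false)
  have hI : ∀ n S, MeasurableSet S → MeasurableSet (I n S) := fun n S hS =>
    MarkerLemma.measurableSet_infinite_section (B := {p | p.2 ∈ L n S ∧ E p.1 p.2})
      ((measurable_snd (hS.inter (hbit n))).inter hBorel)
      (fun x => (hcount x).mono fun _ h => h.2)
  have hI_inv : ∀ n S x y, E x y → (x ∈ I n S ↔ y ∈ I n S) := by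
    intro n S x y h
    simp only [I, Set.mem_ofPred_eq, class_eq h]
  let A : ℕ → Set X := fun n => Nat.rec Set.univ next n
  have A_succ : ∀ n, A (n + 1) = next n (A n) := fun _ => rfl
  have hA : ∀ n, MeasurableSet (A n) := by
    intro n
    induction n with
    | zero => exact MeasurableSet.univ
    | succ n ih =>
      exact ih.inter (((hbit n).inter (hI n _ ih)).union ((hbit n).compl.inter (hI n _ ih).compl))
  have hA_inf : ∀ n x, (A n ∩ {y | E x y}).Infinite := by
    intro n x
    induction n with
    | zero => simpa [A] using haper x
    | succ n ih =>
      by_cases hx : x ∈ I n (A n)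
      · refine Set.Infinite.mono ?_ hx
        rintro y ⟨⟨h1, h2⟩, h3⟩
        exact ⟨⟨h1, Or.inl ⟨h2, (hI_inv n _ x y h3).1 hx⟩⟩, h3⟩
      · refine (ih.sdiff (Set.not_infinite.1 hx)).mono ?_
        rintro y ⟨⟨h1, h3⟩, h2⟩
        exact ⟨⟨h1, Or.inr ⟨fun h => h2 ⟨⟨h1, h⟩, h3⟩, fun h => hx ((hI_inv n _ x y h3).2 h)⟩⟩,
          h3⟩
  have hA_sub : ∀ x, ((⋂ n, A n) ∩ {y | E x y}).Subsingleton := by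
    rintro x y ⟨hy, hxy⟩ z ⟨hz, hxz⟩
    refine hg_inj (funext fun n => ?_)
    have h1 := (Set.mem_iInter.1 hy (n + 1)).2
    have h2 := (Set.mem_iInter.1 hz (n + 1)).2
    have h3 := hI_inv n (A n) y z (hE.trans (hE.symm hxy) hxz)
    rcases h1 with ⟨h1, h1'⟩ | ⟨h1, h1'⟩ <;> rcases h2 with ⟨h2, h2'⟩ | ⟨h2, h2'⟩
    · exact h1.trans h2.symm
    · exact absurd (h3.1 h1') h2'
    · exact absurd (h3.2 h2') h1'
    · simp only [Set.mem_compl_iff, Set.mem_ofPred_eq, Bool.not_eq_false] at h1 h2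
      exact h1.trans h2.symm
  refine ⟨fun n => A n \ ⋂ m, A m, fun n => (hA n).diff (MeasurableSet.iInter hA),
    fun n => Set.sdiff_subset_sdiff_left Set.inter_subset_left, fun n x => ?_, ?_⟩
  · obtain ⟨y, hy, hy'⟩ := ((hA_inf n x).sdiff (hA_sub x).finite).nonempty
    exact ⟨y, ⟨hy.1, fun h => hy' ⟨h, hy.2⟩⟩, hy.2⟩
  · rw [Set.eq_empty_iff_forall_notMem]
    intro x hx
    rw [Set.mem_iInter] at hx
    exact (hx 0).2 (Set.mem_iInter.2 fun n => (hx n).1)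
end

section
/- Let M be a nonempty set and u : M → (ℕ → Bool) an injective function. For n ∈ ℕ let A_n := {x ∈ M | for all z ∈ M, the restriction of u x to {0, …, n−1} is lexicographically ≤ the restriction of u z to {0, …, n−1}}. Then: (a) each A_n is nonempty; (b) A_{n+1} ⊆ A_n for all n; and (c) ⋂_{n ∈ ℕ} A_n = {x ∈ M | u x ≤_lex u z for all z ∈ M}, a set with at most one element. In particular, if the image u(M) has no lexicographically least element, then (A_n) is a decreasing sequence of nonempty subsets of M with empty intersection. -/
/-- `lexLe u v` : `u` is lexicographically at most `v` among binary sequences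
(with `false < true`). -/
def lexLe (u v : ℕ → Bool) : Prop :=
  u = v ∨ ∃ m : ℕ, u m < v m ∧ ∀ k < m, u k = v k

/-- `lexLePrefix n u v` : the restriction of `u` to `{0, …, n-1}` is lexicographically at
most that of `v`. -/
def lexLePrefix (n : ℕ) (u v : ℕ → Bool) : Prop :=
  (∀ k < n, u k = v k) ∨ ∃ m < n, u m < v m ∧ ∀ k < m, u k = v k

theorem lexLePrefix_zero (u v : ℕ → Bool) : lexLePrefix 0 u v :=
  Or.inl fun _ hk => absurd hk (Nat.not_lt_zero _)

theorem lexLePrefix_succ_iff {n : ℕ} {u v : ℕ → Bool} :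
    lexLePrefix (n + 1) u v ↔
      lexLePrefix n u v ∧ ((∀ k < n, u k = v k) → u n ≤ v n) := by
  constructor
  · rintro (h | ⟨m, hm, hlt, heq⟩)
    · exact ⟨Or.inl fun k hk => h k (by omega), fun _ => (h n (by omega)).le⟩
    · rcases Nat.lt_succ_iff_lt_or_eq.mp hm with hm | rfl
      · exact ⟨Or.inr ⟨m, hm, hlt, heq⟩, fun h => absurd (h m hm) hlt.ne⟩
      · exact ⟨Or.inl heq, fun _ => hlt.le⟩
  · rintro ⟨h | ⟨m, hm, hlt, heq⟩, hn⟩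
    · rcases (hn h).lt_or_eq with hlt | he
      · exact Or.inr ⟨n, n.lt_succ_self, hlt, h⟩
      · refine Or.inl fun k hk => ?_
        rcases Nat.lt_succ_iff_lt_or_eq.mp hk with hk | rfl
        · exact h k hk
        · exact he
    · exact Or.inr ⟨m, by omega, hlt, heq⟩

theorem lexLePrefix.congr_left {n : ℕ} {u u' v : ℕ → Bool} (h : lexLePrefix n u v)
    (hu : ∀ k < n, u' k = u k) : lexLePrefix n u' v := by
  rcases h with h | ⟨m, hm, hlt, heq⟩
  · exact Or.inl fun k hk => (hu k hk).trans (h k hk)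
  · exact Or.inr ⟨m, hm, (hu m hm).trans_lt hlt,
      fun k hk => (hu k (hk.trans hm)).trans (heq k hk)⟩

theorem lexLe_iff_forall_lexLePrefix {u v : ℕ → Bool} :
    lexLe u v ↔ ∀ n, lexLePrefix n u v := by
  constructor
  · rintro (rfl | ⟨m, hlt, heq⟩) n
    · exact Or.inl fun _ _ => rfl
    · rcases lt_or_ge m n with hm | hm
      · exact Or.inr ⟨m, hm, hlt, heq⟩
      · exact Or.inl fun k hk => heq k (hk.trans_le hm)
  · intro h
    by_cases hlt : ∃ m : ℕ, u m < v m ∧ ∀ k < m, u k = v k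
    · exact Or.inr hlt
    · refine Or.inl (funext fun k => ?_)
      rcases h (k + 1) with he | ⟨m, -, hm⟩
      · exact he k k.lt_succ_self
      · exact absurd ⟨m, hm⟩ hlt

theorem lexLe.antisymm {u v : ℕ → Bool} (huv : lexLe u v) (hvu : lexLe v u) : u = v := by
  rcases huv with h | ⟨m, hm, hm'⟩
  · exact h
  rcases hvu with h | ⟨l, hl, hl'⟩
  · exact h.symm
  rcases lt_trichotomy m l with h | rfl | h
  · exact absurd (hl' m h).symm hm.ne
  · exact absurd hl hm.asymm
  · exact absurd (hm' l h).symm hl.ne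

theorem exists_forall_lexLePrefix {M : Type*} [Nonempty M] (u : M → (ℕ → Bool)) (n : ℕ) :
    ∃ x, ∀ z, lexLePrefix n (u x) (u z) := by
  induction n with
  | zero => exact ⟨Classical.arbitrary M, fun _ => lexLePrefix_zero _ _⟩
  | succ n ih =>
    obtain ⟨x, hx⟩ := ih
    by_cases hy : ∃ y, (∀ k < n, u y k = u x k) ∧ u y n = false
    · obtain ⟨y, hyx, hyn⟩ := hy
      exact ⟨y, fun z => lexLePrefix_succ_iff.mpr
        ⟨(hx z).congr_left hyx, fun _ => hyn ▸ Bool.false_le _⟩⟩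
    · refine ⟨x, fun z => lexLePrefix_succ_iff.mpr ⟨hx z, fun hxz => ?_⟩⟩
      have hz : u z n = true := by
        by_contra hz
        exact hy ⟨z, fun k hk => (hxz k hk).symm, Bool.eq_false_of_not_eq_true hz⟩
      exact hz ▸ Bool.le_true _

/-- Case 2 of the Slaman–Steel marker lemma: an injection `u : M → 2^ℕ` yields a decreasing
sequence of nonempty sets `A n` (the prefix-lex-minimizers) whose intersection is the set of
lex-least points, which has at most one element. -/
theorem stmt_15 {M : Type*} [Nonempty M] (u : M → (ℕ → Bool))
    (hu : Function.Injective u)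
    (A : ℕ → Set M)
    (hA : ∀ n, A n = {x : M | ∀ z : M, lexLePrefix n (u x) (u z)}) :
    (∀ n, (A n).Nonempty) ∧
    (∀ n, A (n + 1) ⊆ A n) ∧
    (⋂ n, A n) = {x : M | ∀ z : M, lexLe (u x) (u z)} ∧
    Set.Subsingleton {x : M | ∀ z : M, lexLe (u x) (u z)} := by
  refine ⟨fun n => ?_, fun n x hx => ?_, ?_, fun x hx y hy => hu ((hx y).antisymm (hy x))⟩
  · rw [hA]
    exact exists_forall_lexLePrefix u n
  · rw [hA] at hx ⊢
    exact fun z => (lexLePrefix_succ_iff.mp (hx z)).1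
  · ext x
    simp only [hA, Set.mem_iInter, Set.mem_ofPred_eq, lexLe_iff_forall_lexLePrefix]
    exact forall_comm
end

section
/- Let X be a standard Borel space, E a countable Borel equivalence relation on X, and F ⊆ X a Borel set such that F meets every E-class in a finite nonempty set (for every x, the set F ∩ {y | E x y} is finite and nonempty). Then E admits a Borel transversal: a Borel set D ⊆ X meeting every E-class in exactly one point. (A Borel choice of a finite nonempty subset of each class implies smoothness.) -/
open Set PiNat
open MeasureTheory (AnalyticSet AnalyticSet_def exists_measurableEmbedding_real)

/-- A sequence of sets is Borel-separable if its members can be enlarged to measurable sets with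
empty intersection. -/
def MeasurablySeparableSeq {α : Type*} [MeasurableSpace α] (s : ℕ → Set α) : Prop :=
  ∃ u : ℕ → Set α, (∀ n, s n ⊆ u n) ∧ (∀ n, MeasurableSet (u n)) ∧ ⋂ n, u n = ∅

theorem MeasurablySeparableSeq.of_split {α ι : Type*} [MeasurableSpace α] [Countable ι]
    {s : ℕ → Set α} {t : ι → ℕ → Set α} (k : ℕ) (ht : ∀ i, MeasurablySeparableSeq (t i))
    (hk : s k ⊆ ⋃ i, t i k) (hs : ∀ n ≠ k, ∀ i, s n ⊆ t i n) : MeasurablySeparableSeq s := by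
  choose u htu hum hu using ht
  refine ⟨fun n => if n = k then ⋃ i, u i k else ⋂ i, u i n, fun n => ?_, fun n => ?_, ?_⟩
  · by_cases hn : n = k
    · subst hn
      simpa using hk.trans (iUnion_mono fun i => htu i n)
    · simpa [hn] using fun i => (hs n hn i).trans (htu i n)
  · by_cases hn : n = k
    · simpa [hn] using MeasurableSet.iUnion fun i => hum i k
    · simpa [hn] using MeasurableSet.iInter fun i => hum i n
  · refine eq_empty_iff_forall_notMem.2 fun x hx => ?_
    rw [mem_iInter] at hx
    have hxk := hx k
    simp only [if_true, mem_iUnion] at hxk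
    obtain ⟨i, hi⟩ := hxk
    refine eq_empty_iff_forall_notMem.1 (hu i) x (mem_iInter.2 fun n => ?_)
    by_cases hn : n = k
    · rwa [hn]
    · have := hx n
      simp only [hn, if_false, mem_iInter] at this
      exact this i

/-- If a property of cylinders passes from each cylinder to one of its immediate subcylinders, then
it holds along a branch. -/
theorem exists_forall_cylinder {p : Set (ℕ → ℕ) → Prop} (h0 : p univ)
    (hstep : ∀ w m, p (cylinder w m) → ∃ i, p (cylinder (Function.update w m i) (m + 1))) :
    ∃ w, ∀ m, p (cylinder w m) := by
  choose! i hi using hstep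
  let s : ℕ → ℕ → ℕ := fun m => Nat.rec 0 (fun m w => Function.update w m (i w m)) m
  have hs : ∀ m, s (m + 1) = Function.update (s m) m (i (s m) m) := fun m => rfl
  have hps : ∀ m, p (cylinder (s m) m) := by
    intro m
    induction m with
    | zero => simpa using h0
    | succ m ih => exact hi _ _ ih
  have hstab : ∀ m, ∀ j < m, s m j = s (j + 1) j := by
    intro m
    induction m with
    | zero => simp
    | succ m ih =>
      intro j hj
      rcases Nat.lt_succ_iff_lt_or_eq.1 hj with hj | rfl
      · rw [hs m, Function.update_of_ne hj.ne, ih j hj]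
      · rfl
  refine ⟨fun j => s (j + 1) j, fun m => ?_⟩
  have : (fun j => s (j + 1) j) ∈ cylinder (s m) m := fun j hj => (hstab m j hj).symm
  rw [mem_cylinder_iff_eq.1 this]
  exact hps m

theorem exists_cylinder_subset {s : Set (ℕ → ℕ)} (hs : IsOpen s) {w : ℕ → ℕ} (hw : w ∈ s) :
    ∃ m, cylinder w m ⊆ s := by
  obtain ⟨_, ⟨v, m, rfl⟩, hwv, hvs⟩ :=
    (isTopologicalBasis_cylinders fun _ : ℕ => ℕ).exists_subset_of_mem_open hw hs
  exact ⟨m, (mem_cylinder_iff_eq.1 hwv).trans_subset hvs⟩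

/-- The **Novikov separation theorem**: a sequence of analytic sets with empty intersection can be
enlarged to a sequence of Borel sets with empty intersection. -/
theorem measurablySeparableSeq_of_iInter_eq_empty {α : Type*} [TopologicalSpace α] [T2Space α]
    [MeasurableSpace α] [OpensMeasurableSpace α] {s : ℕ → Set α} (hs : ∀ n, AnalyticSet (s n))
    (h : ⋂ n, s n = ∅) : MeasurablySeparableSeq s := by
  by_cases hemp : ∃ n, s n = ∅
  · obtain ⟨k, hk⟩ := hemp
    exact MeasurablySeparableSeq.of_split (ι := Empty) (t := fun i => i.elim) k (fun i => i.elim)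
      (by simp [hk]) (fun _ _ i => i.elim)
  push Not at hemp
  have hs' : ∀ n, ∃ f : (ℕ → ℕ) → α, Continuous f ∧ range f = s n := fun n =>
    ((AnalyticSet_def _).mp (hs n)).resolve_left (hemp n).ne_empty
  choose f hfc hfs using hs'
  let g : ℕ → (ℕ → ℕ) → α := fun n w => f n fun j => w (Nat.pair n j)
  have hgc : ∀ n, Continuous (g n) := fun n => (hfc n).comp (by fun_prop)
  have hgs : ∀ n, range (g n) = s n := by
    intro n
    rw [← hfs n]
    refine (range_subset_iff.2 fun w => mem_range_self _).antisymm
      (range_subset_iff.2 fun v => ⟨fun m => v m.unpair.2, by simp⟩)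
  have hupd : ∀ n m, n ≠ m.unpair.1 → ∀ w i, g n (Function.update w m i) = g n w := by
    intro n m hn w i
    refine congrArg (f n) (funext fun j => Function.update_of_ne ?_ _ _)
    rintro rfl
    simp at hn
  by_contra hsep
  obtain ⟨w, hw⟩ := exists_forall_cylinder
    (p := fun c => ¬ MeasurablySeparableSeq fun n => g n '' c) (by simpa [hgs] using hsep) (by
      intro w m hwm
      by_contra! hcon
      refine hwm (MeasurablySeparableSeq.of_split m.unpair.1 hcon ?_ ?_)
      · rw [← image_iUnion]
        exact image_mono (iUnion_cylinder_update w m).ge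
      · rintro n hn i _ ⟨v, hv, rfl⟩
        refine ⟨Function.update v m i, fun j hj => ?_, hupd n m hn v i⟩
        rcases Nat.lt_succ_iff_lt_or_eq.1 hj with hj | rfl
        · simpa [Function.update_of_ne hj.ne] using hv j hj
        · simp)
  have hne : ∃ i j, g i w ≠ g j w := by
    by_contra! hcon
    refine eq_empty_iff_forall_notMem.1 h (g 0 w) (mem_iInter.2 fun n => ?_)
    rw [hcon 0 n, ← hgs n]
    exact mem_range_self w
  obtain ⟨i, j, hij⟩ := hne
  obtain ⟨U, V, hU, hV, hiU, hjV, hUV⟩ := t2_separation hij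
  obtain ⟨m, hm⟩ := exists_cylinder_subset
    ((hU.preimage (hgc i)).inter (hV.preimage (hgc j))) (w := w) ⟨hiU, hjV⟩
  have hne' : i ≠ j := fun h => hij (h ▸ rfl)
  refine hw m ⟨fun n => if n = i then U else if n = j then V else univ, fun n => ?_, fun n => ?_,
    ?_⟩
  · rintro _ ⟨v, hv, rfl⟩
    dsimp only
    split_ifs with h1 h2
    · exact h1 ▸ (hm hv).1
    · exact h2 ▸ (hm hv).2
    · trivial
  · dsimp only
    split_ifs
    exacts [hU.measurableSet, hV.measurableSet, MeasurableSet.univ]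
  · refine eq_empty_iff_forall_notMem.2 fun x hx => ?_
    have h1 := mem_iInter.1 hx i
    have h2 := mem_iInter.1 hx j
    simp only [if_true, hne'.symm, if_false] at h1 h2
    exact disjoint_left.1 hUV h1 h2

theorem natCast_le_encard_iff_exists_strictMono {α : Type*} [LinearOrder α] (n : ℕ) (s : Set α) :
    (n : ℕ∞) ≤ s.encard ↔ ∃ t : Fin n → α, StrictMono t ∧ ∀ i, t i ∈ s := by
  constructor
  · intro h
    obtain ⟨u, hus, hu⟩ := Set.exists_subset_encard_eq h
    have hfin : u.Finite := Set.finite_of_encard_eq_coe hu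
    have hcard : hfin.toFinset.card = n := by
      rw [hfin.encard_eq_coe_toFinset_card] at hu
      exact_mod_cast hu
    exact ⟨hfin.toFinset.orderEmbOfFin hcard, (hfin.toFinset.orderEmbOfFin hcard).strictMono,
      fun i => hus (hfin.mem_toFinset.1 (Finset.orderEmbOfFin_mem _ _ i))⟩
  · rintro ⟨t, ht, hts⟩
    calc (n : ℕ∞) = (Set.range t).encard := by
          rw [← Set.image_univ, ht.injective.encard_image]; simp
      _ ≤ s.encard := Set.encard_le_encard (Set.range_subset_iff.2 hts)

theorem eq_of_strictMono_of_encard_le {α : Type*} [LinearOrder α] {n : ℕ} {s : Set α}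
    (hs : s.encard ≤ n) {t u : Fin n → α} (ht : StrictMono t) (hu : StrictMono u)
    (hts : ∀ i, t i ∈ s) (hus : ∀ i, u i ∈ s) : t = u := by
  have hfin : s.Finite := Set.finite_of_encard_le_coe hs
  have hcard : hfin.toFinset.card = n := by
    have := hs.antisymm ((natCast_le_encard_iff_exists_strictMono n s).2 ⟨t, ht, hts⟩)
    rw [hfin.encard_eq_coe_toFinset_card] at this
    exact_mod_cast this
  rw [Finset.orderEmbOfFin_unique hcard (fun i => hfin.mem_toFinset.2 (hts i)) ht,
    Finset.orderEmbOfFin_unique hcard (fun i => hfin.mem_toFinset.2 (hus i)) hu]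

theorem measurableSet_strictMono_section {X : Type*} [MeasurableSpace X] {P : Set (X × ℝ)}
    (hP : MeasurableSet P) (n : ℕ) :
    MeasurableSet {p : X × (Fin n → ℝ) | StrictMono p.2 ∧ ∀ i, (p.1, p.2 i) ∈ P} := by
  have : {p : X × (Fin n → ℝ) | StrictMono p.2 ∧ ∀ i, (p.1, p.2 i) ∈ P} =
      (⋂ i, ⋂ j, ⋂ (_ : i < j), {p | p.2 i < p.2 j}) ∩
        ⋂ i, (fun p : X × (Fin n → ℝ) => (p.1, p.2 i)) ⁻¹' P := by
    ext p
    simp [StrictMono]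
  rw [this]
  refine MeasurableSet.inter ?_ ?_
  · refine MeasurableSet.iInter fun i => MeasurableSet.iInter fun j =>
      MeasurableSet.iInter fun _ => ?_
    exact measurableSet_lt (by fun_prop) (by fun_prop)
  · exact MeasurableSet.iInter fun i =>
      (show Measurable fun p : X × (Fin n → ℝ) => (p.1, p.2 i) by fun_prop) hP

theorem setOf_natCast_le_encard_section {X : Type*} (P : Set (X × ℝ)) (n : ℕ) :
    {x | (n : ℕ∞) ≤ {y | (x, y) ∈ P}.encard} =
      Prod.fst '' {p : X × (Fin n → ℝ) | StrictMono p.2 ∧ ∀ i, (p.1, p.2 i) ∈ P} := by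
  ext x
  simp [natCast_le_encard_iff_exists_strictMono]

theorem measurableSet_image_fst_of_encard_le {X : Type*} [MeasurableSpace X] [StandardBorelSpace X]
    (n : ℕ) {P : Set (X × ℝ)} (hP : MeasurableSet P)
    (hn : ∀ x, {y | (x, y) ∈ P}.encard ≤ n) : MeasurableSet (Prod.fst '' P) := by
  induction n generalizing P with
  | zero =>
    have : P = ∅ := by
      ext ⟨x, y⟩
      have := hn x
      simp only [Nat.cast_zero, nonpos_iff_eq_zero, Set.encard_eq_zero] at this
      simpa using Set.eq_empty_iff_forall_notMem.1 this y
    simp [this]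
  | succ n ih =>
    set S := {x | ((n + 1 : ℕ) : ℕ∞) ≤ {y | (x, y) ∈ P}.encard} with hSdef
    have hS : MeasurableSet S := by
      rw [hSdef, setOf_natCast_le_encard_section]
      refine (measurableSet_strictMono_section hP (n + 1)).image_of_measurable_injOn
        measurable_fst ?_
      rintro ⟨x, t⟩ ⟨ht, htP⟩ ⟨x', u⟩ ⟨hu, huP⟩ (rfl : x = x')
      exact congrArg (Prod.mk x) (eq_of_strictMono_of_encard_le (hn x) ht hu htP huP)
    have hP' : MeasurableSet (P ∩ Prod.fst ⁻¹' Sᶜ) := hP.inter (measurable_fst hS.compl)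
    have key : Prod.fst '' P = S ∪ Prod.fst '' (P ∩ Prod.fst ⁻¹' Sᶜ) := by
      ext x
      constructor
      · rintro ⟨p, hp, rfl⟩
        by_cases hpS : p.1 ∈ S
        · exact Or.inl hpS
        · exact Or.inr ⟨p, ⟨hp, hpS⟩, rfl⟩
      · rintro (hx | ⟨p, hp, rfl⟩)
        · have : {y | (x, y) ∈ P}.Nonempty := by
            rw [← Set.encard_pos]
            exact lt_of_lt_of_le (by simp) hx
          obtain ⟨y, hy⟩ := this
          exact ⟨(x, y), hy, rfl⟩
        · exact ⟨p, hp.1, rfl⟩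
    rw [key]
    refine hS.union (ih hP' fun x => ?_)
    by_cases hx : x ∈ S
    · simp [hx]
    · have hx' : {y | (x, y) ∈ P}.encard < ((n + 1 : ℕ) : ℕ∞) := not_le.1 hx
      refine (Set.encard_le_encard fun y hy => hy.1).trans ?_
      push_cast at hx'
      exact ENat.lt_add_one_iff (by simp) |>.1 hx'

/-- A Borel set with finite sections has a Borel projection. -/
theorem measurableSet_image_fst_of_finite {X : Type*} [MeasurableSpace X] [StandardBorelSpace X]
    {P : Set (X × ℝ)} (hP : MeasurableSet P) (hfin : ∀ x, {y | (x, y) ∈ P}.Finite) :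
    MeasurableSet (Prod.fst '' P) := by
  let := upgradeStandardBorel X
  obtain ⟨u, hsu, hum, hu⟩ : MeasurablySeparableSeq
      fun n : ℕ => {x | (n : ℕ∞) ≤ {y | (x, y) ∈ P}.encard} := by
    refine measurablySeparableSeq_of_iInter_eq_empty (fun n => ?_) ?_
    · rw [setOf_natCast_le_encard_section]
      exact (measurableSet_strictMono_section hP n).analyticSet_image measurable_fst
    · refine eq_empty_iff_forall_notMem.2 fun x hx => ?_
      have h := mem_iInter.1 hx ((hfin x).toFinset.card + 1)
      rw [mem_ofPred_eq, (hfin x).encard_eq_coe_toFinset_card, Nat.cast_le] at h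
      lia
  have key : Prod.fst '' P = ⋃ n, Prod.fst '' (P ∩ Prod.fst ⁻¹' (u n)ᶜ) := by
    rw [← image_iUnion, ← inter_iUnion, ← preimage_iUnion, ← compl_iInter, hu]
    simp
  rw [key]
  refine MeasurableSet.iUnion fun n => measurableSet_image_fst_of_encard_le n
    (hP.inter (measurable_fst (hum n).compl)) fun x => ?_
  by_cases hx : x ∈ u n
  · simp [hx]
  · exact (encard_le_encard fun y hy => hy.1).trans (not_le.1 fun h => hx (hsu n h)).le

/-- A Borel choice of a finite nonempty subset of each class of a countable Borel
equivalence relation implies smoothness: the relation admits a Borel transversal. -/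
theorem stmt_16 {X : Type*} [MeasurableSpace X] [StandardBorelSpace X]
    (E : X → X → Prop) (hE : Equivalence E)
    (hBorel : MeasurableSet {p : X × X | E p.1 p.2})
    (hcount : ∀ x : X, {y : X | E x y}.Countable)
    (F : Set X) (hF : MeasurableSet F)
    (hfin : ∀ x : X, (F ∩ {y : X | E x y}).Finite)
    (hne : ∀ x : X, (F ∩ {y : X | E x y}).Nonempty) :
    ∃ D : Set X, MeasurableSet D ∧ ∀ x : X, ∃! y : X, y ∈ D ∧ E x y := by
  obtain ⟨e, he⟩ := exists_measurableEmbedding_real X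
  let Q : Set (X × X) := {p | E p.1 p.2} ∩ (Prod.snd ⁻¹' F ∩ {p | e p.2 < e p.1})
  have hQ : MeasurableSet Q := hBorel.inter ((measurable_snd hF).inter
    (measurableSet_lt (he.measurable.comp measurable_snd) (he.measurable.comp measurable_fst)))
  have hP : MeasurableSet (Prod.map id e '' Q) :=
    (MeasurableEmbedding.id.prodMap he).measurableSet_image.2 hQ
  have hPfin : ∀ x, {r | (x, r) ∈ Prod.map id e '' Q}.Finite := by
    refine fun x => ((hfin x).image e).subset ?_
    rintro _ ⟨⟨x', y⟩, ⟨hxy, hy, -⟩, h⟩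
    obtain ⟨rfl, rfl⟩ := Prod.ext_iff.1 h
    exact ⟨y, ⟨hy, hxy⟩, rfl⟩
  have hmem : ∀ x, x ∈ Prod.fst '' (Prod.map id e '' Q) ↔ ∃ y, E x y ∧ y ∈ F ∧ e y < e x := by
    intro x
    simp [Q]
  refine ⟨F \ Prod.fst '' (Prod.map id e '' Q),
    hF.diff (measurableSet_image_fst_of_finite hP hPfin), fun x => ?_⟩
  obtain ⟨y, ⟨hyF, hxy⟩, hmin⟩ := exists_min_image _ e (hfin x) (hne x)
  refine ⟨y, ⟨⟨hyF, fun h => ?_⟩, hxy⟩, ?_⟩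
  · obtain ⟨z, hyz, hzF, hlt⟩ := (hmem y).1 h
    exact (hmin z ⟨hzF, hE.trans hxy hyz⟩).not_gt hlt
  · rintro z ⟨⟨hzF, hz⟩, hxz⟩
    have hle : e z ≤ e y :=
      not_lt.1 fun h => hz ((hmem z).2 ⟨y, hE.trans (hE.symm hxz) hxy, hyF, h⟩)
    exact he.injective (hle.antisymm (hmin z ⟨hzF, hxz⟩))
end

section
/- Feldman–Moore theorem for groupoids: Let X and G be standard Borel spaces equipped with Borel maps d, r : G → X (domain and codomain), e : X → G (identity), inv : G → G (inverse), and a Borel composition m defined on the Borel set {(g, h) ∈ G × G | d g = r h}, satisfying the groupoid axioms: d(e x) = x = r(e x); d(m(g, h)) = d h and r(m(g, h)) = r g for composable pairs; m is associative where defined; m(g, e(d g)) = g = m(e(r g), g); d(inv g) = r g and r(inv g) = d g; m(inv g, g) = e(d g) and m(g, inv g) = e(r g). Assume every fiber d⁻¹(x) is countable (G is a locally countable Borel groupoid). Then there exists a sequence of Borel maps (σ_n : X → G)_{n ∈ ℕ} such that: (a) d(σ_n x) = x for all n and x; (b) for each n, the map τ_n : X → X, x ↦ r(σ_n x), is a bijection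 of X with τ_n and τ_n⁻¹ Borel (each σ_n is a total Borel bisection); and (c) for every g ∈ G there is n with σ_n(d g) = g (the bisections cover G). -/
open Set Filter Topology MeasureTheory

/-- A set is covered exactly by countably many measurable sets on each of which `d` is
injective. -/
def IsSigmaInjOn {X G : Type*} [MeasurableSpace G] (d : G → X) (S : Set G) : Prop :=
  ∃ 𝓑 : Set (Set G), 𝓑.Countable ∧ (∀ B ∈ 𝓑, MeasurableSet B ∧ InjOn d B) ∧ ⋃₀ 𝓑 = S

namespace IsSigmaInjOn

variable {X G : Type*} [MeasurableSpace G] {d : G → X}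

theorem measurableSet {S : Set G} (h : IsSigmaInjOn d S) : MeasurableSet S := by
  obtain ⟨𝓑, hc, hB, rfl⟩ := h
  exact MeasurableSet.sUnion hc fun B hBm => (hB B hBm).1

theorem of_injOn {S : Set G} (hS : MeasurableSet S) (hd : InjOn d S) : IsSigmaInjOn d S :=
  ⟨{S}, countable_singleton S, by simp [hS, hd], by simp⟩

theorem iUnion {ι : Type*} [Countable ι] {S : ι → Set G} (h : ∀ i, IsSigmaInjOn d (S i)) :
    IsSigmaInjOn d (⋃ i, S i) := by
  choose 𝓑 hc hB hS using h
  refine ⟨⋃ i, 𝓑 i, countable_iUnion hc, ?_, ?_⟩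
  · intro B hBm
    obtain ⟨i, hi⟩ := mem_iUnion.1 hBm
    exact hB i B hi
  · rw [sUnion_iUnion]
    exact iUnion_congr hS

theorem union {S T : Set G} (hS : IsSigmaInjOn d S) (hT : IsSigmaInjOn d T) :
    IsSigmaInjOn d (S ∪ T) := by
  rw [union_eq_iUnion]
  exact iUnion fun b => by cases b <;> assumption

theorem exists_seq {S : Set G} (h : IsSigmaInjOn d S) :
    ∃ B : ℕ → Set G, (∀ n, MeasurableSet (B n) ∧ InjOn d (B n)) ∧ ⋃ n, B n = S := by
  obtain ⟨𝓑, hc, hB, rfl⟩ := h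
  have hne : (insert ∅ 𝓑).Nonempty := insert_nonempty _ _
  obtain ⟨B, hBr⟩ := (hc.insert ∅).exists_eq_range hne
  refine ⟨B, fun n => ?_, ?_⟩
  · have hn : B n ∈ insert ∅ 𝓑 := hBr ▸ mem_range_self n
    rcases hn with hn | hn
    · simp [hn]
    · exact hB _ hn
  · rw [← sUnion_range, ← hBr]
    simp

end IsSigmaInjOn

/-- If a measurable function is injective on the part of a measurable set lying over an analytic
set, then it is injective on some measurable superset of that part. -/
theorem exists_measurableSet_superset_injOn {X G : Type*} [TopologicalSpace X] [PolishSpace X]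
    [MeasurableSpace X] [BorelSpace X] [MeasurableSpace G] [StandardBorelSpace G]
    {d : G → X} (hd : Measurable d) {W : Set G} (hW : MeasurableSet W) {D : Set X}
    (hD : AnalyticSet D) (hinj : InjOn d (W ∩ d ⁻¹' D)) :
    ∃ B, MeasurableSet B ∧ InjOn d B ∧ W ∩ d ⁻¹' D ⊆ B := by
  let := upgradeStandardBorel G
  obtain ⟨S, hS, hsep⟩ := exists_seq_separating G (p := IsOpen) isOpen_empty univ
  have hinter : ∀ T : Set G, MeasurableSet T → AnalyticSet (d '' (W ∩ T) ∩ D) := by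
    intro T hT
    rw [inter_eq_iInter]
    refine AnalyticSet.iInter fun b => ?_
    cases b
    · exact hD
    · exact (hW.inter hT).analyticSet_image hd
  have hex : ∀ n, MeasurablySeparable (d '' (W ∩ S n) ∩ D) (d '' (W ∩ (S n)ᶜ) ∩ D) := by
    intro n
    refine (hinter _ (hS n).measurableSet).measurablySeparable
      (hinter _ (hS n).measurableSet.compl) ?_
    rw [Set.disjoint_left]
    rintro _ ⟨⟨g, ⟨hgW, hgS⟩, rfl⟩, hgD⟩ ⟨⟨h, ⟨hhW, hhS⟩, hh⟩, -⟩
    have : h = g := hinj ⟨hhW, by rw [mem_preimage, hh]; exact hgD⟩ ⟨hgW, hgD⟩ hh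
    exact hhS (this ▸ hgS)
  choose U hU1 hU2 hUm using hex
  refine ⟨⋂ n, {g | g ∈ S n ↔ d g ∈ U n}, MeasurableSet.iInter fun n => ?_, ?_, ?_⟩
  · exact (hS n).measurableSet.mem.iff (hd (hUm n)).mem |>.setOf
  · intro g hg h hh hgh
    refine hsep g trivial h trivial fun n => ?_
    have h1 := mem_iInter.1 hg n
    have h2 := mem_iInter.1 hh n
    simp only [mem_ofPred_eq] at h1 h2
    rw [h1, h2, hgh]
  · rintro g ⟨hgW, hgD⟩
    refine mem_iInter.2 fun n => ⟨fun hgS => hU1 n ⟨⟨g, ⟨hgW, hgS⟩, rfl⟩, hgD⟩, fun hgU => ?_⟩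
    by_contra hgS
    exact Set.disjoint_left.1 (hU2 n) ⟨⟨g, ⟨hgW, hgS⟩, rfl⟩, hgD⟩ hgU

/-- A sequence of sets such that, after removing any set covered by countably many measurable
injectivity domains of `d`, some fiber of `d` still meets all of its members. -/
def IsLargeFamily {X G : Type*} [MeasurableSpace G] (d : G → X) (W : ℕ → Set G) : Prop :=
  ∀ S, IsSigmaInjOn d S → ∃ c : ℕ → G, (∀ i, c i ∈ W i \ S) ∧ ∀ i j, d (c i) = d (c j)

/-- In a large family, a member can be split into two disjoint pieces, the first being small,
by using up a member which has not been constrained yet. -/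
theorem IsLargeFamily.exists_split {X G : Type*} [TopologicalSpace X] [PolishSpace X]
    [MeasurableSpace X] [BorelSpace X] [MetricSpace G] [PolishSpace G] [MeasurableSpace G]
    [BorelSpace G] {d : G → X} (hd : Measurable d) {W : ℕ → Set G} (hW : IsLargeFamily d W)
    (hWc : ∀ i, IsClosed (W i)) {i j : ℕ} (hij : i ≠ j) {ε : ℝ} (hε : 0 < ε) :
    ∃ U V : Set G, IsClosed U ∧ IsClosed V ∧ Disjoint U V ∧
      (∀ x ∈ U, ∀ y ∈ U, dist x y ≤ ε) ∧
      IsLargeFamily d (Function.update (Function.update W i (W i ∩ U)) j (W i ∩ V)) := by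
  have hne : Nonempty G := by
    obtain ⟨c, -⟩ := hW ∅ (.of_injOn .empty (injOn_empty d))
    exact ⟨c 0⟩
  by_contra H
  let q := TopologicalSpace.denseSeq G
  let U : ℕ → ℕ → Set G := fun p k => Metric.closedBall (q p) (1 / (k + 1))
  have hex : ∀ t : {t : ℕ × ℕ × ℕ // Disjoint (U t.1 t.2.2) (U t.2.1 t.2.2) ∧
      (∀ x ∈ U t.1 t.2.2, ∀ y ∈ U t.1 t.2.2, dist x y ≤ ε)}, ∃ S, IsSigmaInjOn d S ∧
      ¬ ∃ c : ℕ → G, (∀ l, c l ∈ Function.update (Function.update W i (W i ∩ U t.1.1 t.1.2.2)) j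
        (W i ∩ U t.1.2.1 t.1.2.2) l \ S) ∧ ∀ l l', d (c l) = d (c l') := by
    rintro ⟨t, ht1, ht2⟩
    by_contra H'
    refine H ⟨_, _, Metric.isClosed_closedBall, Metric.isClosed_closedBall, ht1, ht2, ?_⟩
    intro S hS
    by_contra H''
    exact H' ⟨S, hS, H''⟩
  choose S hS hSn using hex
  have hT : IsSigmaInjOn d (⋃ t, S t) := .iUnion hS
  set T := ⋃ t, S t with hTdef
  have hWm : ∀ l, MeasurableSet (W l \ T) := fun l => (hWc l).measurableSet.diff hT.measurableSet
  have hD : AnalyticSet (⋂ l, d '' (W l \ T)) :=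
    AnalyticSet.iInter fun l => (hWm l).analyticSet_image hd
  have hinj : InjOn d ((W i \ T) ∩ d ⁻¹' (⋂ l, d '' (W l \ T))) := by
    rintro g ⟨⟨hgW, hgT⟩, hgD⟩ h ⟨⟨hhW, hhT⟩, -⟩ hgh
    by_contra hne'
    have hpos : 0 < dist g h := dist_pos.2 hne'
    obtain ⟨k, hk⟩ := exists_nat_one_div_lt (show 0 < min (ε / 2) (dist g h / 4) by positivity)
    have hk1 := hk.trans_le (min_le_left _ _)
    have hk2 := hk.trans_le (min_le_right _ _)
    have hk0 : (0 : ℝ) < 1 / (k + 1) := by positivity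
    obtain ⟨p, hp⟩ := (TopologicalSpace.denseRange_denseSeq G).exists_dist_lt g hk0
    obtain ⟨p', hp'⟩ := (TopologicalSpace.denseRange_denseSeq G).exists_dist_lt h hk0
    refine hSn ⟨(p, p', k), ?_, ?_⟩ ?_
    · rw [Set.disjoint_left]
      intro z hz hz'
      have h1 : dist z (q p) ≤ 1 / (k + 1) := hz
      have h2 : dist z (q p') ≤ 1 / (k + 1) := hz'
      have h3 : dist g (q p) < 1 / (k + 1) := hp
      have h4 : dist h (q p') < 1 / (k + 1) := hp'
      have h5 := dist_triangle_right g z (q p)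
      have h6 := dist_triangle_right z h (q p')
      have h7 := dist_triangle g z h
      linarith
    · intro x hx y hy
      have h1 : dist x (q p) ≤ 1 / (k + 1) := hx
      have h2 : dist y (q p) ≤ 1 / (k + 1) := hy
      have h5 := dist_triangle_right x y (q p)
      linarith
    · have hc : ∀ l, ∃ c, c ∈ W l \ T ∧ d c = d g := fun l => mem_iInter.1 hgD l
      choose c hc1 hc2 using hc
      have hnT : ∀ t, ∀ x, x ∉ T → x ∉ S t := fun t x hx hxt => hx (mem_iUnion.2 ⟨t, hxt⟩)
      refine ⟨Function.update (Function.update c i g) j h, fun l => ?_, ?_⟩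
      · refine ⟨?_, hnT _ _ ?_⟩
        · by_cases hlj : l = j
          · subst hlj
            simpa using ⟨hhW, hp'.le⟩
          · by_cases hli : l = i
            · subst hli
              simpa [hlj] using ⟨hgW, hp.le⟩
            · simpa [hlj, hli] using (hc1 l).1
        · by_cases hlj : l = j
          · subst hlj
            simpa using hhT
          · by_cases hli : l = i
            · subst hli
              simpa [hlj] using hgT
            · simpa [hlj, hli] using (hc1 l).2
      · have hdg : ∀ l, d (Function.update (Function.update c i g) j h l) = d g := by
          intro l
          by_cases hlj : l = j
          · subst hlj
            simpa using hgh.symm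
          · by_cases hli : l = i
            · subst hli
              simp [hlj]
            · simpa [hlj, hli] using hc2 l
        intro l l'
        rw [hdg, hdg]
  obtain ⟨B, hBm, hBi, hB⟩ := exists_measurableSet_superset_injOn hd (hWm i) hD hinj
  obtain ⟨c, hc1, hc2⟩ := hW (T ∪ B) (hT.union (.of_injOn hBm hBi))
  refine (hc1 i).2 (Or.inr (hB ⟨⟨(hc1 i).1, fun h => (hc1 i).2 (Or.inl h)⟩, ?_⟩))
  exact mem_iInter.2 fun l => ⟨c l, ⟨(hc1 l).1, fun h => (hc1 l).2 (Or.inl h)⟩, hc2 l i⟩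

/-- Starting from a large constant family, iterated splitting produces decreasing sequences of
closed sets along which the family stays large. -/
theorem IsLargeFamily.exists_scheme {X G : Type*} [TopologicalSpace X] [PolishSpace X]
    [MeasurableSpace X] [BorelSpace X] [MetricSpace G] [PolishSpace G] [MeasurableSpace G]
    [BorelSpace G] {d : G → X} (hd : Measurable d)
    (huniv : IsLargeFamily d fun _ => (univ : Set G)) :
    ∃ W : ℕ → ℕ → Set G, (∀ n, IsLargeFamily d (W n)) ∧ (∀ n i, IsClosed (W n i)) ∧
      (∀ n i, W (n + 1) i ⊆ W n i) ∧
      (∀ n, W (n + 1) (n + 1) ⊆ W n n.unpair.1) ∧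
      (∀ n, Disjoint (W (n + 1) n.unpair.1) (W (n + 1) (n + 1))) ∧
      (∀ n, ∀ x ∈ W (n + 1) n.unpair.1, ∀ y ∈ W (n + 1) n.unpair.1,
        dist x y ≤ 1 / ((n : ℝ) + 1)) := by
  let P : ℕ → (ℕ → Set G) → Prop := fun n W =>
    IsLargeFamily d W ∧ (∀ i, IsClosed (W i)) ∧ ∀ i, n < i → W i = univ
  let R : ℕ → (ℕ → Set G) → (ℕ → Set G) → Prop := fun n W W' =>
    (∀ i, W' i ⊆ W i) ∧ W' (n + 1) ⊆ W n.unpair.1 ∧ Disjoint (W' n.unpair.1) (W' (n + 1)) ∧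
      ∀ x ∈ W' n.unpair.1, ∀ y ∈ W' n.unpair.1, dist x y ≤ 1 / ((n : ℝ) + 1)
  have step : ∀ n (W : {W // P n W}), ∃ W' : {W // P (n + 1) W}, R n W.1 W'.1 := by
    rintro n ⟨W, hW, hWc, hWu⟩
    have hle := Nat.unpair_left_le n
    have hij : n.unpair.1 ≠ n + 1 := by omega
    have hε : (0 : ℝ) < 1 / ((n : ℝ) + 1) := by positivity
    obtain ⟨U, V, hU, hV, hUV, hdist, hL⟩ := hW.exists_split hd hWc hij hε
    refine ⟨⟨_, hL, fun i => ?_, fun i hi => ?_⟩, fun i => ?_, ?_, ?_, ?_⟩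
    · by_cases hi : i = n + 1
      · subst hi
        simpa using (hWc _).inter hV
      · by_cases hi' : i = n.unpair.1
        · subst hi'
          simpa [hi] using (hWc _).inter hU
        · simpa [hi, hi'] using hWc i
    · have h1 : i ≠ n + 1 := by omega
      have h2 : i ≠ n.unpair.1 := by omega
      simpa [h1, h2] using hWu i (by omega)
    · by_cases hi : i = n + 1
      · subst hi
        simp [hWu (n + 1) (by omega)]
      · by_cases hi' : i = n.unpair.1
        · subst hi'
          simp [hi]
        · simp [hi, hi']
    · simp
    · simpa [hij] using hUV.mono inter_subset_right inter_subset_right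
    · intro x hx y hy
      simp only [ne_eq, hij, not_false_eq_true, Function.update_of_ne,
        Function.update_self] at hx hy
      exact hdist x hx.2 y hy.2
  choose next hnext using step
  let F : (n : ℕ) → {W // P n W} := fun n =>
    Nat.rec ⟨fun _ => univ, huniv, fun _ => isClosed_univ, fun _ _ => rfl⟩ next n
  exact ⟨fun n => (F n).1, fun n => (F n).2.1, fun n => (F n).2.2.1, fun n => (hnext n (F n)).1,
    fun n => (hnext n (F n)).2.1, fun n => (hnext n (F n)).2.2.1, fun n => (hnext n (F n)).2.2.2⟩

/-- A continuous map between Polish spaces for which the whole space is large has an uncountable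
fiber. -/
theorem IsLargeFamily.exists_not_countable_fiber {X G : Type*} [TopologicalSpace X] [PolishSpace X]
    [MeasurableSpace X] [BorelSpace X] [MetricSpace G] [PolishSpace G] [CompleteSpace G]
    [MeasurableSpace G] [BorelSpace G] {d : G → X} (hd : Continuous d)
    (huniv : IsLargeFamily d fun _ => (univ : Set G)) :
    ∃ x, ¬ {g | d g = x}.Countable := by
  obtain ⟨W, hL, hc, hmono, hsub, hdisj, hdist⟩ := huniv.exists_scheme hd.measurable
  have hanti : ∀ i, Antitone fun n => W n i := fun i => antitone_nat_of_succ_le fun n => hmono n i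
  have hsmall : ∀ i (ε : ℝ), 0 < ε → ∃ N, ∀ x ∈ W N i, ∀ y ∈ W N i, dist x y < ε := by
    intro i ε hε
    obtain ⟨k, hk⟩ := exists_nat_one_div_lt hε
    refine ⟨Nat.pair i k + 1, fun x hx y hy => ?_⟩
    have h := hdist (Nat.pair i k) x (by simpa using hx) y (by simpa using hy)
    refine h.trans_lt (lt_of_le_of_lt ?_ hk)
    have : (k : ℝ) ≤ Nat.pair i k := by exact_mod_cast Nat.right_le_pair i k
    gcongr
  have hpt : ∀ n, ∃ c : ℕ → G, (∀ i, c i ∈ W n i) ∧ ∀ i j, d (c i) = d (c j) := by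
    intro n
    obtain ⟨c, h1, h2⟩ := hL n ∅ (.of_injOn .empty (injOn_empty d))
    exact ⟨c, fun i => (h1 i).1, h2⟩
  choose c hcW hcd using hpt
  have hlim : ∀ i, ∃ g, Tendsto (fun n => c n i) atTop (𝓝 g) := by
    intro i
    refine cauchySeq_tendsto_of_complete (Metric.cauchySeq_iff.2 fun ε hε => ?_)
    obtain ⟨N, hN⟩ := hsmall i ε hε
    exact ⟨N, fun m hm n hn => hN _ (hanti i hm (hcW m i)) _ (hanti i hn (hcW n i))⟩
  choose g hg using hlim
  have hgW : ∀ n i, g i ∈ W n i := fun n i =>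
    (hc n i).mem_of_tendsto (hg i) ((eventually_ge_atTop n).mono fun m hm => hanti i hm (hcW m i))
  have hgd : ∀ i, d (g i) = d (g 0) := by
    intro i
    refine tendsto_nhds_unique ((hd.tendsto _).comp (hg i)) (((hd.tendsto _).comp (hg 0)).congr ?_)
    exact fun n => hcd n 0 i
  have hpre : Preperfect (range g) := by
    rw [preperfect_iff_nhds]
    rintro _ ⟨i, rfl⟩ U hU
    obtain ⟨ε, hε, hball⟩ := Metric.mem_nhds_iff.1 hU
    obtain ⟨N, hN⟩ := hsmall i ε hε
    have hi : (Nat.pair i N).unpair.1 = i := by simp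
    have hmem := hsub (Nat.pair i N) (hgW _ _)
    have hdis := hdisj (Nat.pair i N)
    rw [hi] at hmem hdis
    refine ⟨g (Nat.pair i N + 1), ⟨hball ?_, mem_range_self _⟩, fun h => ?_⟩
    · exact hN _ (hanti i (Nat.right_le_pair i N) hmem) _ (hgW N i)
    · exact Set.disjoint_left.1 hdis (hgW _ i) (h ▸ hgW _ _)
  refine ⟨d (g 0), fun hcount => ?_⟩
  obtain ⟨f, hf, -, hfi⟩ := hpre.perfect_closure.exists_nat_bool_injection
    (range_nonempty g).closure
  have hclosed : IsClosed {h | d h = d (g 0)} := isClosed_singleton.preimage hd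
  have hss : range f ⊆ {h | d h = d (g 0)} :=
    hf.trans (closure_minimal (range_subset_iff.2 hgd) hclosed)
  have : Countable (ℕ → Bool) :=
    countable_univ_iff.1 (countable_of_injective_of_countable_image hfi.injOn
      (by simpa using hcount.mono hss))
  obtain ⟨F, hF⟩ := exists_surjective_nat (ℕ → Bool)
  obtain ⟨n, hn⟩ := hF fun n => !F n n
  simpa using congrFun hn n

/-- **Lusin–Novikov**: a countable-to-one measurable map between standard Borel spaces is injective
on each piece of some countable measurable cover of its domain. -/
theorem exists_iUnion_injOn_of_countable_fibers {X G : Type*} [MeasurableSpace X]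
    [StandardBorelSpace X] [MeasurableSpace G] [StandardBorelSpace G] {d : G → X}
    (hd : Measurable d) (hcount : ∀ x, {g | d g = x}.Countable) :
    ∃ B : ℕ → Set G, (∀ n, MeasurableSet (B n) ∧ InjOn d (B n)) ∧ ⋃ n, B n = univ := by
  refine IsSigmaInjOn.exists_seq ?_
  let := upgradeStandardBorel X
  obtain ⟨t, hb, hp⟩ := StandardBorelSpace.polish (α := G)
  obtain ⟨t', htt', hcont, hp'⟩ := hd.exists_continuous
  have hb' : @BorelSpace G t' _ :=
    @BorelSpace.mk G t' _ (hb.measurable_eq.trans (borel_eq_borel_of_le hp' hp htt').symm)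
  clear hp hb htt'
  clear t
  let := TopologicalSpace.upgradeIsCompletelyMetrizable G
  by_contra hns
  have hlarge : IsLargeFamily d fun _ => (univ : Set G) := by
    intro S hS
    have : S ≠ univ := fun h => hns (h ▸ hS)
    obtain ⟨g, hg⟩ := (ne_univ_iff_exists_notMem S).1 this
    exact ⟨fun _ => g, fun _ => ⟨trivial, hg⟩, fun _ _ => rfl⟩
  obtain ⟨x, hx⟩ := hlarge.exists_not_countable_fiber hcont
  exact hx (hcount x)

/-- A measurable set of arrows on which the domain map is injective extends, by identities, to a
measurable total section of the domain map. -/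
theorem exists_measurable_section_extending {X G : Type*} [MeasurableSpace X]
    [StandardBorelSpace X] [MeasurableSpace G] [StandardBorelSpace G] {d : G → X} {e : X → G}
    (hd : Measurable d) (he : Measurable e) (hde : ∀ x, d (e x) = x) {C : Set G}
    (hC : MeasurableSet C) (hinj : InjOn d C) :
    ∃ s : X → G, Measurable s ∧ (∀ x, d (s x) = x) ∧ (∀ g ∈ C, s (d g) = g) ∧
      ∀ x, s x ∈ C ∨ s x = e x := by
  classical
  let s : X → G := fun x => if h : ∃ g ∈ C, d g = x then h.choose else e x
  have hsC : ∀ g ∈ C, s (d g) = g := by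
    intro g hg
    have h : ∃ g' ∈ C, d g' = d g := ⟨g, hg, rfl⟩
    have hs : s (d g) = h.choose := dif_pos h
    rw [hs]
    exact hinj h.choose_spec.1 hg h.choose_spec.2
  have hse : ∀ x, x ∉ d '' C → s x = e x := fun x hx => dif_neg hx
  refine ⟨s, fun A hA => ?_, fun x => ?_, hsC, fun x => ?_⟩
  · have : s ⁻¹' A = d '' (C ∩ A) ∪ (e ⁻¹' A \ d '' C) := by
      ext x
      by_cases hx : x ∈ d '' C
      · obtain ⟨g, hg, rfl⟩ := hx
        constructor
        · intro h
          rw [mem_preimage, hsC g hg] at h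
          exact Or.inl ⟨g, ⟨hg, h⟩, rfl⟩
        · rintro (⟨g', ⟨hg', hA'⟩, h⟩ | h)
          · rw [mem_preimage, ← h, hsC g' hg']
            exact hA'
          · exact absurd ⟨g, hg, rfl⟩ h.2
      · rw [mem_preimage, hse x hx]
        constructor
        · exact fun h => Or.inr ⟨h, hx⟩
        · rintro (⟨g', ⟨hg', -⟩, h⟩ | h)
          · exact absurd ⟨g', hg', h⟩ hx
          · exact h.1
    rw [this]
    exact ((hC.inter hA).image_of_measurable_injOn hd (hinj.mono inter_subset_left)).union
      ((he hA).diff (hC.image_of_measurable_injOn hd hinj))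
  · by_cases hx : x ∈ d '' C
    · obtain ⟨g, hg, rfl⟩ := hx
      rw [hsC g hg]
    · rw [hse x hx, hde]
  · by_cases hx : x ∈ d '' C
    · obtain ⟨g, hg, rfl⟩ := hx
      exact Or.inl ((hsC g hg).symm ▸ hg)
    · exact Or.inr (hse x hx)

/-- A measurable set of arrows which is injective for the domain map, and which is either
contained in the isotropy or closed under inversion, is contained in a total Borel bisection. -/
theorem exists_bisection_extending {X G : Type*} [MeasurableSpace X]
    [StandardBorelSpace X] [MeasurableSpace G] [StandardBorelSpace G] {d r : G → X} {e : X → G}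
    {inv : G → G} (hd : Measurable d) (hr : Measurable r) (he : Measurable e)
    (hde : ∀ x, d (e x) = x) (hre : ∀ x, r (e x) = x) (hdinv : ∀ g, d (inv g) = r g)
    (hrinv : ∀ g, r (inv g) = d g) {C : Set G} (hC : MeasurableSet C) (hinj : InjOn d C)
    (hsymm : ∀ g ∈ C, d g = r g ∨ inv g ∈ C) :
    ∃ s : X → G, Measurable s ∧ (∀ x, d (s x) = x) ∧
      (∃ τ : X ≃ X, Measurable ⇑τ ∧ Measurable ⇑τ.symm ∧ ∀ x, τ x = r (s x)) ∧
      ∀ g ∈ C, s (d g) = g := by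
  obtain ⟨s, hs, hds, hsC, hs'⟩ := exists_measurable_section_extending hd he hde hC hinj
  have hinvol : Function.Involutive fun x => r (s x) := by
    intro x
    change r (s (r (s x))) = x
    rcases hs' x with hx | hx
    · rcases hsymm _ hx with h | h
      · rw [← h, hds, ← h, hds]
      · rw [← hdinv (s x), hsC _ h, hrinv, hds]
    · rw [hx, hre, hx, hre]
  exact ⟨s, hs, hds, ⟨hinvol.toPerm _, hr.comp hs, hr.comp hs, fun _ => rfl⟩, hsC⟩


/-- **Feldman–Moore theorem for groupoids**: every locally countable Borel groupoid is
covered by countably many total Borel bisections. -/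
theorem stmt_17 {X G : Type*} [MeasurableSpace X] [StandardBorelSpace X]
    [MeasurableSpace G] [StandardBorelSpace G]
    (d r : G → X) (e : X → G) (inv : G → G) (m : G → G → G)
    (hd : Measurable d) (hr : Measurable r) (he : Measurable e) (hinv : Measurable inv)
    (hcompSet : MeasurableSet {p : G × G | d p.1 = r p.2})
    (hm : Measurable (fun p : {p : G × G // d p.1 = r p.2} => m p.1.1 p.1.2))
    (hde : ∀ x, d (e x) = x) (hre : ∀ x, r (e x) = x)
    (hdm : ∀ g h, d g = r h → d (m g h) = d h)
    (hrm : ∀ g h, d g = r h → r (m g h) = r g)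
    (hassoc : ∀ g h k, d g = r h → d h = r k → m (m g h) k = m g (m h k))
    (hidr : ∀ g, m g (e (d g)) = g) (hidl : ∀ g, m (e (r g)) g = g)
    (hdinv : ∀ g, d (inv g) = r g) (hrinv : ∀ g, r (inv g) = d g)
    (hinvl : ∀ g, m (inv g) g = e (d g)) (hinvr : ∀ g, m g (inv g) = e (r g))
    (hloc : ∀ x : X, {g : G | d g = x}.Countable) :
    ∃ σ : ℕ → X → G,
      (∀ n, Measurable (σ n)) ∧
      (∀ n x, d (σ n x) = x) ∧
      (∀ n, ∃ τ : X ≃ X, Measurable ⇑τ ∧ Measurable ⇑τ.symm ∧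
        ∀ x, τ x = r (σ n x)) ∧
      (∀ g : G, ∃ n, σ n (d g) = g) := by
  have hinvinv : ∀ g, inv (inv g) = g := by
    intro g
    have h1 : m (m (inv (inv g)) (inv g)) g = m (inv (inv g)) (m (inv g) g) :=
      hassoc _ _ _ (by rw [hdinv]) (by rw [hdinv])
    have h2 : d g = d (inv (inv g)) := by rw [hdinv, hrinv]
    rw [hinvl (inv g), hdinv, hidl, hinvl g, h2, hidr] at h1
    exact h1.symm
  obtain ⟨B, hB, hBu⟩ := exists_iUnion_injOn_of_countable_fibers hd hloc
  obtain ⟨S, hS, hsep⟩ := exists_seq_separating X (p := MeasurableSet) MeasurableSet.empty univ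
  let K : ℕ × ℕ × ℕ → Set G := fun t =>
    (B t.1 ∩ inv ⁻¹' B t.2.1) ∩ {g | d g ∈ S t.2.2 ∧ r g ∉ S t.2.2}
  have hKm : ∀ t, MeasurableSet (K t) := fun t =>
    ((hB _).1.inter (hinv (hB _).1)).inter ((hd (hS _)).inter (hr (hS _)).compl)
  let C : ℕ ⊕ ℕ × ℕ × ℕ → Set G :=
    Sum.elim (fun n => B n ∩ {g | d g = r g}) fun t => K t ∪ inv ⁻¹' K t
  have hCm : ∀ t, MeasurableSet (C t) := by
    rintro (n | t)
    · exact (hB n).1.inter (measurableSet_eq_fun hd hr)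
    · exact (hKm t).union (hinv (hKm t))
  have hCi : ∀ t, InjOn d (C t) := by
    rintro (n | t)
    · exact (hB n).2.mono inter_subset_left
    · rintro g (hg | hg) h (hh | hh) hgh
      · exact (hB _).2 hg.1.1 hh.1.1 hgh
      · refine absurd hg.2.1 ?_
        rw [hgh, ← hrinv]
        exact hh.2.2
      · refine absurd hh.2.1 ?_
        rw [← hgh, ← hrinv]
        exact hg.2.2
      · have hg' := hg.1.2
        have hh' := hh.1.2
        rw [mem_preimage, hinvinv] at hg' hh'
        exact (hB _).2 hg' hh' hgh
  have hCs : ∀ t, ∀ g ∈ C t, d g = r g ∨ inv g ∈ C t := by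
    rintro (n | t) g hg
    · exact Or.inl hg.2
    · rcases hg with hg | hg
      · exact Or.inr (Or.inr (by rwa [mem_preimage, hinvinv]))
      · exact Or.inr (Or.inl hg)
  have hcov : ∀ g, ∃ t, g ∈ C t := by
    intro g
    have hBg : ∀ g, ∃ n, g ∈ B n := fun g => mem_iUnion.1 (hBu ▸ mem_univ g)
    obtain ⟨n, hn⟩ := hBg g
    obtain ⟨k, hk⟩ := hBg (inv g)
    by_cases h : d g = r g
    · exact ⟨Sum.inl n, hn, h⟩
    · have : ∃ l, ¬ (d g ∈ S l ↔ r g ∈ S l) := by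
        by_contra! H
        exact h (hsep _ trivial _ trivial H)
      obtain ⟨l, hl⟩ := this
      by_cases hdl : d g ∈ S l
      · exact ⟨Sum.inr (n, k, l), Or.inl ⟨⟨hn, hk⟩, hdl, fun hrl => hl ⟨fun _ => hrl, fun _ => hdl⟩⟩⟩
      · have hrl : r g ∈ S l := by tauto
        refine ⟨Sum.inr (k, n, l), Or.inr ⟨⟨hk, ?_⟩, ?_, ?_⟩⟩
        · rwa [mem_preimage, hinvinv]
        · rwa [hdinv]
        · rwa [hrinv]
  choose s hs hds hτ hsC using fun t =>
    exists_bisection_extending hd hr he hde hre hdinv hrinv (hCm t) (hCi t) (hCs t)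
  obtain ⟨f, hf⟩ := exists_surjective_nat (ℕ ⊕ ℕ × ℕ × ℕ)
  refine ⟨fun n => s (f n), fun n => hs _, fun n => hds _, fun n => hτ _, fun g => ?_⟩
  obtain ⟨t, ht⟩ := hcov g
  obtain ⟨n, rfl⟩ := hf t
  exact ⟨n, hsC _ g ht⟩
end

section
/- Every involution of ℤ commuting with the successor map is the identity: if b : ℤ → ℤ satisfies b(b(x)) = x and b(x + 1) = b(x) + 1 for all x ∈ ℤ, then b(x) = x for all x. Consequently, there is no transitive action on ℤ of a group generated by elements of order at most 2 in which every group element acts by a permutation commuting with the translation x ↦ x + 1: if Γ is a group generated by a set of elements γ with γ² = 1 and Γ acts on ℤ with γ • (x + 1) = (γ • x) + 1 for all γ ∈ Γ and x ∈ ℤ, then the action is not transitive. -/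
theorem Int.apply_eq_add_of_map_add_one {b : ℤ → ℤ} (hb : ∀ x, b (x + 1) = b x + 1) (x : ℤ) :
    b x = b 0 + x := by
  induction x using Int.induction_on with
  | zero => simp
  | succ n ih => rw [hb, ih, add_assoc]
  | pred n ih =>
    have h := hb (-n - 1)
    rw [sub_add_cancel] at h
    omega

theorem Int.eq_self_of_involutive_of_map_add_one {b : ℤ → ℤ} (hinv : ∀ x, b (b x) = x)
    (hb : ∀ x, b (x + 1) = b x + 1) (x : ℤ) : b x = x := by
  have h₀ := hinv 0
  have h₁ := Int.apply_eq_add_of_map_add_one hb (b 0)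
  have h₂ := Int.apply_eq_add_of_map_add_one hb x
  omega

/-- Every involution of `ℤ` commuting with the successor map is the identity; consequently,
no group generated by elements of order at most 2 can act transitively on `ℤ` with every
element acting by a permutation commuting with the translation `x ↦ x + 1`. -/
theorem stmt_18 :
    (∀ b : ℤ → ℤ, (∀ x, b (b x) = x) → (∀ x, b (x + 1) = b x + 1) → ∀ x, b x = x) ∧
    (∀ (Γ : Type) [Group Γ] (S : Set Γ) (a : Γ →* Equiv.Perm ℤ),
      Subgroup.closure S = ⊤ →
      (∀ γ ∈ S, γ * γ = 1) →
      (∀ (γ : Γ) (x : ℤ), a γ (x + 1) = a γ x + 1) →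
      ¬ ∀ x y : ℤ, ∃ γ : Γ, a γ x = y) := by
  refine ⟨fun b hinv hb => Int.eq_self_of_involutive_of_map_add_one hinv hb, ?_⟩
  intro Γ _ S a hS hinv hcomm htrans
  have hker : Subgroup.closure S ≤ a.ker := by
    rw [Subgroup.closure_le]
    intro γ hγ
    refine MonoidHom.mem_ker.mpr (Equiv.ext fun x => ?_)
    refine Int.eq_self_of_involutive_of_map_add_one (fun y => ?_) (hcomm γ) x
    rw [← Equiv.Perm.mul_apply, ← map_mul, hinv γ hγ, map_one, Equiv.Perm.one_apply]
  obtain ⟨γ, hγ⟩ := htrans 0 1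
  have hγ_one : a γ = 1 := MonoidHom.mem_ker.mp (hker (hS ▸ Subgroup.mem_top γ))
  simp [hγ_one] at hγ
end
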